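/- Let i be a nonnegative integer and let α, β, ε be complex numbers. Assume that (β)_{m+n} is nonzero for all nonnegative integers m, n, that no argument of Γ appearing on the right-hand side below is a nonpositive integer, and that the double series defining the Kampé de Fériet function converges absolutely. Then F^{0:2;2}_{1:0;0}[— : α, ε ; β−ε, 1−α−ε+i ; β : — ; — ; 1/2, −1] = (2^{α−i+2ε−2} · Γ(1−ε) · Γ(β)) / (Γ(1−ε+i) · Γ(β+ε−i−1)) · Σ_{r=0}^{i} (−1)^r · C(i,r) · Γ((β+ε−i+r−1)/2) / Γ((β−ε−i+r+1)/2). -/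

import Mathlib

open Complex

noncomputable section

/-- Pochhammer symbol `(a)_n = a (a+1) ⋯ (a+n-1)`. -/
def poch (a : ℂ) (n : ℕ) : ℂ := ∏ k ∈ Finset.range n, (a + k)

/-- `z` is not a nonpositive integer. -/
def notNonposInt (z : ℂ) : Prop := ∀ n : ℕ, z ≠ -(n : ℂ)

/-- Term of the Kampé de Fériet double series `F^{0:2;2}_{1:0;0}`. -/
def kdfTerm (a₁ a₂ b₁ b₂ β x y : ℂ) (p : ℕ × ℕ) : ℂ :=
  poch a₁ p.1 * poch a₂ p.1 * poch b₁ p.2 * poch b₂ p.2 /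
    poch β (p.1 + p.2) * x ^ p.1 * y ^ p.2 /
    ((p.1.factorial : ℂ) * (p.2.factorial : ℂ))


theorem poch_zero (a : ℂ) : poch a 0 = 1 := by simp [poch]

theorem poch_succ (a : ℂ) (n : ℕ) : poch a (n + 1) = poch a n * (a + n) := by
  simp [poch, Finset.prod_range_succ]

theorem poch_succ_left (a : ℂ) (n : ℕ) : poch a (n + 1) = a * poch (a + 1) n := by
  simp only [poch, Finset.prod_range_succ']
  rw [mul_comm]
  congr 1
  · simp
  · refine Finset.prod_congr rfl fun k _ => ?_
    push_cast
    ring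

theorem poch_add (a : ℂ) (m n : ℕ) : poch a (m + n) = poch a m * poch (a + m) n := by
  rw [poch, poch, poch, Finset.prod_range_add]
  refine congrArg _ (Finset.prod_congr rfl fun k _ => ?_)
  push_cast
  ring

theorem poch_one (n : ℕ) : poch 1 n = (n.factorial : ℂ) := by
  induction n with
  | zero => simp [poch_zero]
  | succ n ih =>
    rw [poch_succ, ih, Nat.factorial_succ]
    push_cast
    ring

theorem norm_le_mul_pow_of_ratio {u : ℕ → ℂ} (a c : ℂ)
    (hu : ∀ᶠ n : ℕ in Filter.atTop, u (n + 1) = u n * ((a + n) / (c + n))) {ρ : ℝ} (hρ : 1 < ρ) :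
    ∃ C : ℝ, 0 < C ∧ ∀ n, ‖u n‖ ≤ C * ρ ^ n := by
  have h0 : 0 < ρ := by linarith
  have hlim : Filter.Tendsto (fun n : ℕ => ‖(a + n) / (c + n)‖) Filter.atTop (nhds 1) := by
    have h := tendsto_add_mul_div_add_mul_atTop_nhds (𝕜 := ℂ) a c 1 one_ne_zero
    simpa using h.norm
  obtain ⟨N, hN⟩ := Filter.eventually_atTop.1 ((hlim.eventually (gt_mem_nhds hρ)).and hu)
  obtain ⟨C, hC, hCN⟩ : ∃ C : ℝ, 0 < C ∧ ∀ n ≤ N, ‖u n‖ ≤ C * ρ ^ n := by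
    refine ⟨1 + ∑ n ∈ Finset.range (N + 1), ‖u n‖, by positivity, ?_⟩
    intro n hn
    have h1 : ‖u n‖ ≤ ∑ n ∈ Finset.range (N + 1), ‖u n‖ :=
      Finset.single_le_sum (f := fun n => ‖u n‖) (fun _ _ => norm_nonneg _)
        (Finset.mem_range.2 (by omega))
    have h2 : 1 ≤ ρ ^ n := one_le_pow₀ hρ.le
    calc _ ≤ 1 + ∑ n ∈ Finset.range (N + 1), ‖u n‖ := by linarith
      _ ≤ _ := le_mul_of_one_le_right (by positivity) h2
  refine ⟨C, hC, fun n => ?_⟩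
  induction n with
  | zero => exact hCN 0 (Nat.zero_le _)
  | succ n ih =>
    rcases Nat.lt_or_ge n N with h | h
    · exact hCN _ h
    · rw [(hN n h).2, norm_mul, pow_succ, ← mul_assoc]
      exact mul_le_mul ih (hN n h).1.le (norm_nonneg _) (by positivity)

theorem norm_poch_div_poch_le (a c : ℂ) {ρ : ℝ} (hρ : 1 < ρ) :
    ∃ C : ℝ, 0 < C ∧ ∀ n, ‖poch a n / poch c n‖ ≤ C * ρ ^ n :=
  norm_le_mul_pow_of_ratio a c
    (Filter.Eventually.of_forall fun n => by rw [poch_succ, poch_succ, mul_div_mul_comm]) hρ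

theorem sum_choose_mul_poch_mul_poch (a b : ℂ) (N : ℕ) :
    ∑ p ∈ Finset.HasAntidiagonal.antidiagonal N, (N.choose p.1 : ℂ) * (poch a p.1 * poch b p.2) =
      poch (a + b) N := by
  induction N with
  | zero => simp [poch_zero]
  | succ N ih =>
    rw [Finset.sum_antidiagonal_choose_succ_mul (fun i j => poch a i * poch b j),
      ← Finset.sum_add_distrib, poch_succ, ← ih, Finset.sum_mul]
    refine Finset.sum_congr rfl fun p hp => ?_
    have hp := Finset.HasAntidiagonal.mem_antidiagonal.1 hp
    rw [← Nat.choose_symm_of_eq_add hp.symm, poch_succ, poch_succ, ← hp]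
    push_cast
    ring

theorem sum_choose_mul_neg_one_pow_mul_poch (a c : ℂ) (N : ℕ) :
    ∑ p ∈ Finset.HasAntidiagonal.antidiagonal N,
      (N.choose p.1 : ℂ) * ((-1) ^ p.1 * poch a p.1 * poch (c + p.1) p.2) = poch (c - a) N := by
  induction N generalizing c with
  | zero => simp [poch_zero]
  | succ N ih =>
    rw [Finset.sum_antidiagonal_choose_succ_mul
      (fun i j => (-1) ^ i * poch a i * poch (c + i) j),
      ← Finset.sum_add_distrib, poch_succ_left, sub_add_eq_add_sub, ← ih, Finset.mul_sum]
    refine Finset.sum_congr rfl fun p hp => ?_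
    have hp := Finset.HasAntidiagonal.mem_antidiagonal.1 hp
    rw [← Nat.choose_symm_of_eq_add hp.symm, poch_succ_left (c + p.1), poch_succ a]
    push_cast
    rw [show c + 1 + (p.1 : ℂ) = c + p.1 + 1 by ring, show c + ((p.1 : ℂ) + 1) = c + p.1 + 1 by ring]
    ring

theorem tsum_prod_eq_tsum_antidiagonal {F : ℕ × ℕ → ℂ} (hF : Summable F) :
    ∑' p, F p = ∑' N, ∑ p ∈ Finset.HasAntidiagonal.antidiagonal N, F p := by
  rw [← Finset.HasAntidiagonal.sigmaAntidiagonalEquivProd.tsum_eq F]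
  have h := Finset.HasAntidiagonal.sigmaAntidiagonalEquivProd.summable_iff.2 hF
  refine (h.tsum_sigma' fun _ => Summable.of_finite).trans (tsum_congr fun N => ?_)
  rw [tsum_fintype]
  exact Finset.sum_coe_sort _ F

theorem choose_neg_eq_poch (b : ℂ) (n : ℕ) :
    Ring.choose (-b) n = (-1) ^ n * poch b n / n.factorial := by
  have h : (descPochhammer ℤ n).smeval (-b) = (-1) ^ n * poch b n := by
    induction n with
    | zero => simp [poch_zero]
    | succ n ih =>
      rw [descPochhammer_succ_right, Polynomial.smeval_mul, ih, poch_succ]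
      simp [Polynomial.smeval_sub, Polynomial.smeval_natCast]
      ring
  rw [Ring.choose_eq_smul, h, div_eq_inv_mul]
  simp

theorem hasSum_poch_mul_pow (b : ℂ) {y : ℂ} (hy : ‖y‖ < 1) :
    HasSum (fun n => poch b n / n.factorial * y ^ n) ((1 - y) ^ (-b)) := by
  have h := (Complex.one_add_cpow_hasFPowerSeriesOnBall_zero (a := -b)).hasSum (y := -y)
    (by simpa [← ofReal_norm] using hy)
  simp only [zero_add, binomialSeries_apply, choose_neg_eq_poch] at h
  have hf : (fun n => poch b n / n.factorial * y ^ n) =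
      fun n : ℕ => ((-1) ^ n * poch b n / n.factorial) • (List.ofFn fun _ : Fin n => -y).prod := by
    funext n
    have h1 : ((-1 : ℂ) ^ n) * (-1) ^ n = 1 := by rw [← mul_pow]; simp
    rw [List.ofFn_const, List.prod_replicate, smul_eq_mul, neg_pow y]
    linear_combination (-(poch b n / n.factorial * y ^ n)) * h1
  rw [sub_eq_add_neg, hf]
  exact h

theorem summable_geometric_prod {K r : ℝ} (h0 : 0 ≤ r) (h1 : r < 1) :
    Summable fun p : ℕ × ℕ => K * r ^ (p.1 + p.2) := by
  have h := summable_geometric_of_lt_one h0 h1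
  simpa only [pow_add] using
    (h.mul_of_nonneg h (fun n => pow_nonneg h0 n) (fun n => pow_nonneg h0 n)).mul_left K

theorem pfaff_of_norm_lt (a b c : ℂ) (hc : ∀ n, poch c n ≠ 0) {y : ℂ} (hy : ‖y‖ < 1 / 8) :
    ∑' n : ℕ, poch a n * poch b n / (poch c n * n.factorial) * y ^ n =
      (1 - y) ^ (-b) *
        ∑' n : ℕ, poch (c - a) n * poch b n / (poch c n * n.factorial) * (y / (y - 1)) ^ n := by
  have hy1 : 1 - y ≠ 0 := by
    intro h
    rw [← sub_eq_zero.1 h, norm_one] at hy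
    norm_num at hy
  let F : ℕ × ℕ → ℂ := fun p => (-1) ^ p.1 * poch (c - a) p.1 * poch b (p.1 + p.2) /
    (poch c p.1 * (p.1.factorial * p.2.factorial)) * y ^ (p.1 + p.2)
  have hF : Summable F := by
    obtain ⟨C, hC, hCb⟩ := norm_poch_div_poch_le (c - a) c one_lt_two
    obtain ⟨D, hD, hDb⟩ := norm_poch_div_poch_le b 1 one_lt_two
    refine Summable.of_norm_bounded
      (summable_geometric_prod (K := C * D) (r := 8 * ‖y‖) (by positivity) (by linarith)) ?_
    rintro ⟨n, k⟩
    have hFe : F (n, k) = (-1) ^ n * (poch (c - a) n / poch c n) *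
        (poch b (n + k) / poch 1 (n + k)) * ((n + k).choose n : ℂ) * y ^ (n + k) := by
      have h1 : ((n + k).choose n : ℂ) = (n + k).factorial / (n.factorial * k.factorial) := by
        rw [Nat.cast_add_choose]
      have h2 : ((n + k).factorial : ℂ) ≠ 0 := by exact_mod_cast (n + k).factorial_ne_zero
      have h3 : (n.factorial : ℂ) ≠ 0 := by exact_mod_cast n.factorial_ne_zero
      have h4 : (k.factorial : ℂ) ≠ 0 := by exact_mod_cast k.factorial_ne_zero
      have h5 := hc n
      simp only [F]
      rw [h1, poch_one]
      field_simp
    have h1 : ((n + k).choose n : ℝ) ≤ 2 ^ (n + k) := by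
      exact_mod_cast Nat.choose_le_two_pow (n + k) n
    have h2 : (2 : ℝ) ^ n ≤ 2 ^ (n + k) := pow_le_pow_right₀ one_le_two (by omega)
    rw [hFe]
    simp only [norm_mul, norm_pow, norm_neg, norm_one, one_pow, one_mul, Complex.norm_natCast]
    calc _ ≤ (C * 2 ^ (n + k)) * (D * 2 ^ (n + k)) * 2 ^ (n + k) * ‖y‖ ^ (n + k) := by
          gcongr
          · exact (hCb n).trans (by gcongr)
          · exact hDb _
      _ = _ := by
          rw [show (8 : ℝ) = 2 * 2 * 2 by norm_num]
          simp only [mul_pow]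
          ring
  have e1 : ∑' p, F p = ∑' n : ℕ, poch a n * poch b n / (poch c n * n.factorial) * y ^ n := by
    rw [tsum_prod_eq_tsum_antidiagonal hF]
    refine tsum_congr fun N => ?_
    have h := sum_choose_mul_neg_one_pow_mul_poch (c - a) c N
    rw [sub_sub_cancel] at h
    rw [← h, Finset.sum_mul, Finset.sum_div, Finset.sum_mul]
    refine Finset.sum_congr rfl fun p hp => ?_
    obtain ⟨n, k⟩ := p
    obtain rfl : n + k = N := Finset.HasAntidiagonal.mem_antidiagonal.1 hp
    have h2 : ((n + k).factorial : ℂ) ≠ 0 := by exact_mod_cast (n + k).factorial_ne_zero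
    have h3 : (n.factorial : ℂ) ≠ 0 := by exact_mod_cast n.factorial_ne_zero
    have h4 : (k.factorial : ℂ) ≠ 0 := by exact_mod_cast k.factorial_ne_zero
    have h5 := hc n
    have h6 := hc (n + k)
    rw [poch_add] at h6
    have h7 := right_ne_zero_of_mul h6
    simp only [F]
    rw [Nat.cast_add_choose, poch_add c]
    field_simp
  have e2 : ∑' p, F p = (1 - y) ^ (-b) *
      ∑' n : ℕ, poch (c - a) n * poch b n / (poch c n * n.factorial) * (y / (y - 1)) ^ n := by
    rw [hF.tsum_prod, ← tsum_mul_left]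
    refine tsum_congr fun n => ?_
    have h := (hasSum_poch_mul_pow (b + n) (y := y) (by linarith)).tsum_eq
    rw [neg_add, ← sub_eq_add_neg, cpow_sub _ _ hy1, cpow_natCast] at h
    have h1 : (y / (y - 1)) ^ n = (-1) ^ n * (y ^ n / (1 - y) ^ n) := by
      rw [← div_pow, ← mul_pow, ← neg_sub 1 y, div_neg]
      ring
    rw [h1]
    calc _ = ∑' k, ((-1) ^ n * poch (c - a) n * poch b n / (poch c n * n.factorial) * y ^ n) *
          (poch (b + n) k / k.factorial * y ^ k) := by
          refine tsum_congr fun k => ?_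
          simp only [F]
          rw [poch_add, pow_add]
          have h3 : (n.factorial : ℂ) ≠ 0 := by exact_mod_cast n.factorial_ne_zero
          have h4 : (k.factorial : ℂ) ≠ 0 := by exact_mod_cast k.factorial_ne_zero
          have h5 := hc n
          field_simp
      _ = _ := by
          rw [tsum_mul_left, h]
          ring
  rw [← e1, e2]

theorem summable_hypergeometric (a b c : ℂ) {r : ℝ} (h0 : 0 ≤ r) (h1 : r < 1) :
    Summable fun n : ℕ => ‖poch a n * poch b n / (poch c n * n.factorial)‖ * r ^ n := by
  set ρ : ℝ := 1 + (1 - r) / 4 with hρ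
  have hρ1 : 1 < ρ := by linarith
  have hρr : ρ * ρ * r < 1 := by nlinarith [mul_nonneg h0 h0, mul_pos (sub_pos.2 h1) (sub_pos.2 h1)]
  obtain ⟨C, hC, hCb⟩ := norm_poch_div_poch_le a c hρ1
  obtain ⟨D, hD, hDb⟩ := norm_poch_div_poch_le b 1 hρ1
  refine Summable.of_nonneg_of_le (fun n => by positivity) (fun n => ?_)
    ((summable_geometric_of_lt_one (by positivity) hρr).mul_left (C * D))
  rw [← poch_one, mul_div_mul_comm, norm_mul]
  calc _ ≤ (C * ρ ^ n) * (D * ρ ^ n) * r ^ n := by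
        gcongr
        · exact hCb n
        · exact hDb n
    _ = _ := by
        simp only [mul_pow]
        ring

theorem differentiableOn_hypergeometric (a b c : ℂ) :
    DifferentiableOn ℂ
      (fun w : ℂ => ∑' n : ℕ, poch a n * poch b n / (poch c n * n.factorial) * w ^ n)
      (Metric.ball 0 1) := by
  intro w hw
  rw [mem_ball_zero_iff] at hw
  obtain ⟨r, hwr, hr⟩ := exists_between hw
  have hr0 : 0 ≤ r := (norm_nonneg w).trans hwr.le
  have h : DifferentiableOn ℂ
      (fun w : ℂ => ∑' n : ℕ, poch a n * poch b n / (poch c n * n.factorial) * w ^ n)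
      (Metric.ball 0 r) := by
    refine differentiableOn_tsum_of_summable_norm (summable_hypergeometric a b c hr0 hr)
      (fun n => by fun_prop) Metric.isOpen_ball fun n z hz => ?_
    rw [mem_ball_zero_iff] at hz
    rw [norm_mul, norm_pow]
    gcongr
  exact ((h w (mem_ball_zero_iff.2 hwr)).differentiableAt
    (Metric.isOpen_ball.mem_nhds (mem_ball_zero_iff.2 hwr))).differentiableWithinAt

theorem norm_div_sub_one_lt_one {y : ℂ} (hy : y.re < 1 / 2) : ‖y / (y - 1)‖ < 1 := by
  have h1 : 0 < ‖y - 1‖ := by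
    rw [norm_pos_iff]
    intro h
    rw [sub_eq_zero.1 h, one_re] at hy
    norm_num at hy
  rw [norm_div, div_lt_one h1]
  refine lt_of_pow_lt_pow_left₀ 2 h1.le ?_
  rw [← normSq_eq_norm_sq, ← normSq_eq_norm_sq, normSq_apply, normSq_apply]
  simp only [sub_re, one_re, sub_im, one_im]
  nlinarith

theorem pfaff_neg_one (a b c : ℂ) (hc : ∀ n, poch c n ≠ 0)
    (hs : Summable fun n : ℕ => ‖poch a n * poch b n / (poch c n * n.factorial)‖) :
    ∑' n : ℕ, poch a n * poch b n / (poch c n * n.factorial) * (-1) ^ n =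
      2 ^ (-b) *
        ∑' n : ℕ, poch (c - a) n * poch b n / (poch c n * n.factorial) * (1 / 2) ^ n := by
  let f : ℂ → ℂ := fun y => ∑' n : ℕ, poch a n * poch b n / (poch c n * n.factorial) * y ^ n
  let g : ℂ → ℂ := fun y => (1 - y) ^ (-b) *
    ∑' n : ℕ, poch (c - a) n * poch b n / (poch c n * n.factorial) * (y / (y - 1)) ^ n
  let H : Set ℂ := {y | y.re < 1 / 2}
  have hH : IsOpen H := isOpen_lt continuous_re continuous_const
  have hf : DifferentiableOn ℂ f (Metric.ball 0 1) := differentiableOn_hypergeometric a b c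
  have hfc : ContinuousOn f (Metric.closedBall 0 1) := by
    refine continuousOn_tsum (fun n => by fun_prop) hs fun n y hy => ?_
    rw [mem_closedBall_zero_iff] at hy
    rw [norm_mul, norm_pow]
    exact mul_le_of_le_one_right (norm_nonneg _) (pow_le_one₀ (norm_nonneg _) hy)
  have hg : DifferentiableOn ℂ g H := by
    refine DifferentiableOn.mul ?_ ?_
    · refine DifferentiableOn.cpow (by fun_prop) (by fun_prop) fun y hy => Or.inl ?_
      have hy : y.re < 1 / 2 := hy
      rw [sub_re, one_re]
      linarith
    · refine (differentiableOn_hypergeometric (c - a) b c).comp (t := Metric.ball 0 1) (s := H)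
        (f := fun y : ℂ => y / (y - 1)) ?_ ?_
      · refine DifferentiableOn.div (by fun_prop) (by fun_prop) fun y hy h => ?_
        have hy : y.re < 1 / 2 := hy
        rw [sub_eq_zero.1 h, one_re] at hy
        norm_num at hy
      · intro y hy
        exact mem_ball_zero_iff.2 (norm_div_sub_one_lt_one hy)
  have hU : IsOpen (Metric.ball (0 : ℂ) 1 ∩ H) := Metric.isOpen_ball.inter hH
  have hEq : Set.EqOn f g (Metric.ball 0 1 ∩ H) := by
    refine AnalyticOnNhd.eqOn_of_preconnected_of_eventuallyEq (𝕜 := ℂ) (z₀ := 0)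
      ((hf.mono Set.inter_subset_left).analyticOnNhd hU)
      ((hg.mono Set.inter_subset_right).analyticOnNhd hU)
      ((convex_ball 0 1).inter (convex_halfSpace_re_lt _)).isPreconnected
      ⟨Metric.mem_ball_self one_pos, by simp [H]⟩ ?_
    filter_upwards [Metric.ball_mem_nhds (0 : ℂ) (show (0 : ℝ) < 1 / 8 by norm_num)] with y hy
    exact pfaff_of_norm_lt a b c hc (mem_ball_zero_iff.1 hy)
  have hI : Set.EqOn (fun t : ℝ => f (-t)) (fun t : ℝ => g (-t)) (Set.Icc 0 1) := by
    refine Set.EqOn.of_subset_closure (s := Set.Ico 0 1) (fun t ht => hEq ⟨?_, ?_⟩) ?_ ?_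
      Set.Ico_subset_Icc_self (closure_Ico zero_ne_one).ge
    · simpa [abs_of_nonneg ht.1] using ht.2
    · have := ht.1
      simp only [H, Set.mem_ofPred_eq, neg_re, ofReal_re]
      linarith
    · refine hfc.comp (by fun_prop) fun t ht => ?_
      simpa [abs_of_nonneg ht.1] using ht.2
    · refine hg.continuousOn.comp (by fun_prop) fun t ht => ?_
      have := ht.1
      simp only [H, Set.mem_ofPred_eq, neg_re, ofReal_re]
      linarith
  have h := hI (Set.right_mem_Icc.2 zero_le_one)
  simp only [f, g, ofReal_one] at h
  rw [h]
  norm_num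

theorem tsum_tsum_half_eq (α ε b β : ℂ) (hβ : ∀ n, poch β n ≠ 0) :
    ∑' m : ℕ, ∑' n : ℕ, poch ε (m + n) * poch α m * poch b n /
        (poch β (m + n) * (m.factorial * n.factorial)) * (1 / 2 : ℂ) ^ (m + n) =
      ∑' N : ℕ, poch ε N * poch (α + b) N / (poch β N * N.factorial) * (1 / 2) ^ N := by
  let F : ℕ × ℕ → ℂ := fun p => poch ε (p.1 + p.2) * poch α p.1 * poch b p.2 /
    (poch β (p.1 + p.2) * (p.1.factorial * p.2.factorial)) * (1 / 2 : ℂ) ^ (p.1 + p.2)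
  have hF : Summable F := by
    have hρ : (1 : ℝ) < 5 / 4 := by norm_num
    obtain ⟨C, hC, hCb⟩ := norm_poch_div_poch_le ε β hρ
    obtain ⟨D, hD, hDb⟩ := norm_poch_div_poch_le α 1 hρ
    obtain ⟨E, hE, hEb⟩ := norm_poch_div_poch_le b 1 hρ
    refine Summable.of_norm_bounded
      (summable_geometric_prod (K := C * D * E) (r := 25 / 32) (by norm_num) (by norm_num)) ?_
    rintro ⟨m, n⟩
    have hFe : F (m, n) = (poch ε (m + n) / poch β (m + n)) * (poch α m / poch 1 m) *
        (poch b n / poch 1 n) * (1 / 2) ^ (m + n) := by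
      simp only [F, poch_one]
      rw [div_mul_div_comm, div_mul_div_comm, mul_assoc (poch β _)]
    rw [hFe]
    simp only [norm_mul, norm_pow, norm_div, norm_one, Complex.norm_ofNat]
    simp only [norm_div] at hCb hDb hEb
    calc _ ≤ (C * (5 / 4) ^ (m + n)) * (D * (5 / 4) ^ m) * (E * (5 / 4) ^ n) *
          (1 / 2) ^ (m + n) := by
          gcongr
          · exact hCb _
          · exact hDb _
          · exact hEb _
      _ = _ := by
          rw [show (25 / 32 : ℝ) = 5 / 4 * (5 / 4) * (1 / 2) by norm_num]
          simp only [mul_pow]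
          ring
  rw [← hF.tsum_prod (f := F), tsum_prod_eq_tsum_antidiagonal hF]
  refine tsum_congr fun N => ?_
  rw [← sum_choose_mul_poch_mul_poch, Finset.mul_sum, Finset.sum_div, Finset.sum_mul]
  refine Finset.sum_congr rfl fun p hp => ?_
  obtain ⟨n, k⟩ := p
  obtain rfl : n + k = N := Finset.HasAntidiagonal.mem_antidiagonal.1 hp
  have h2 : ((n + k).factorial : ℂ) ≠ 0 := by exact_mod_cast (n + k).factorial_ne_zero
  have h3 : (n.factorial : ℂ) ≠ 0 := by exact_mod_cast n.factorial_ne_zero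
  have h4 : (k.factorial : ℂ) ≠ 0 := by exact_mod_cast k.factorial_ne_zero
  have h5 := hβ (n + k)
  simp only [F]
  rw [Nat.cast_add_choose]
  field_simp

theorem tsum_kdfTerm_eq_hypergeometric (α ε b β : ℂ) (hβ : ∀ n, poch β n ≠ 0)
    (hsum : Summable fun p : ℕ × ℕ => ‖kdfTerm α ε (β - ε) b β (1 / 2) (-1) p‖) :
    ∑' p : ℕ × ℕ, kdfTerm α ε (β - ε) b β (1 / 2) (-1) p =
      2 ^ (-b) * ∑' N : ℕ, poch ε N * poch (α + b) N / (poch β N * N.factorial) * (1 / 2) ^ N := by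
  rw [hsum.of_norm.tsum_prod, ← tsum_tsum_half_eq α ε b β hβ, ← tsum_mul_left]
  refine tsum_congr fun m => ?_
  have hβm : ∀ n, poch (β + m) n ≠ 0 := fun n => by
    have h := hβ (m + n)
    rw [poch_add] at h
    exact right_ne_zero_of_mul h
  set K : ℂ := poch α m * poch ε m / (poch β m * m.factorial) * (1 / 2) ^ m with hK
  have h3 : (m.factorial : ℂ) ≠ 0 := by exact_mod_cast m.factorial_ne_zero
  have h5 := hβ m
  have hk (n : ℕ) : kdfTerm α ε (β - ε) b β (1 / 2) (-1) (m, n) =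
      K * (poch (β - ε) n * poch b n / (poch (β + m) n * n.factorial) * (-1) ^ n) := by
    have h4 : (n.factorial : ℂ) ≠ 0 := by exact_mod_cast n.factorial_ne_zero
    have h6 := hβm n
    rw [kdfTerm, hK, poch_add]
    field_simp
  have hG (n : ℕ) : poch ε (m + n) * poch α m * poch b n /
        (poch β (m + n) * (m.factorial * n.factorial)) * (1 / 2 : ℂ) ^ (m + n) =
      K * (poch (ε + m) n * poch b n / (poch (β + m) n * n.factorial) * (1 / 2) ^ n) := by
    have h4 : (n.factorial : ℂ) ≠ 0 := by exact_mod_cast n.factorial_ne_zero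
    have h6 := hβm n
    rw [hK, poch_add, poch_add, pow_add]
    field_simp
  simp only [hk, hG, tsum_mul_left]
  by_cases hK0 : K = 0
  · simp [hK0]
  have hs : Summable fun n : ℕ => ‖poch (β - ε) n * poch b n / (poch (β + m) n * n.factorial)‖ := by
    have h := hsum.comp_injective (Prod.mk_right_injective m)
    simp only [Function.comp_def, hk, norm_mul, norm_pow, norm_neg, norm_one, one_pow, mul_one] at h
    simpa using (summable_mul_left_iff (norm_ne_zero_iff.2 hK0)).1 h
  rw [pfaff_neg_one _ _ _ hβm hs, show β + m - (β - ε) = ε + m by ring]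
  ring

/-- Term of the series `₂F₁(a, b; c; 1/2) / Γ(c)`. -/
def regTerm (a b c : ℂ) (n : ℕ) : ℂ :=
  poch a n * poch b n / n.factorial * (Gamma (c + n))⁻¹ * (1 / 2) ^ n

theorem regTerm_eq_mul_regTerm_add_one (a b c : ℂ) (n : ℕ) :
    regTerm a b c n = (c + n) * regTerm a b (c + 1) n := by
  rw [regTerm, regTerm, one_div_Gamma_eq_self_mul_one_div_Gamma_add_one (c + n),
    add_right_comm c (n : ℂ) 1]
  ring

theorem summable_regTerm (a b c : ℂ) : Summable (regTerm a b c) := by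
  have hρ : (1 : ℝ) < 5 / 4 := by norm_num
  have hu : ∀ᶠ n : ℕ in Filter.atTop, ((n + 1).factorial : ℂ) * (Gamma (c + (n + 1 : ℕ)))⁻¹ =
      n.factorial * (Gamma (c + n))⁻¹ * ((1 + n) / (c + n)) := by
    obtain ⟨M, hM⟩ := exists_nat_gt (-c.re)
    filter_upwards [Filter.eventually_ge_atTop M] with n hn
    have hcn : c + n ≠ 0 := by
      intro h
      have h1 := congrArg re h
      have h2 : (M : ℝ) ≤ n := by exact_mod_cast hn
      simp only [add_re, natCast_re, zero_re] at h1
      linarith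
    rw [one_div_Gamma_eq_self_mul_one_div_Gamma_add_one (c + n), Nat.factorial_succ]
    push_cast
    rw [← add_assoc]
    field_simp
    ring
  obtain ⟨C, hC, hCb⟩ := norm_le_mul_pow_of_ratio
    (u := fun n : ℕ => (n.factorial : ℂ) * (Gamma (c + n))⁻¹) 1 c hu hρ
  obtain ⟨D, hD, hDb⟩ := norm_poch_div_poch_le a 1 hρ
  obtain ⟨E, hE, hEb⟩ := norm_poch_div_poch_le b 1 hρ
  refine Summable.of_norm_bounded ((summable_geometric_of_lt_one (r := 125 / 128) (by norm_num)
    (by norm_num)).mul_left (D * E * C)) fun n => ?_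
  have h1 : regTerm a b c n = (poch a n / poch 1 n) * (poch b n / poch 1 n) *
      ((n.factorial : ℂ) * (Gamma (c + n))⁻¹) * (1 / 2) ^ n := by
    have h3 : (n.factorial : ℂ) ≠ 0 := by exact_mod_cast n.factorial_ne_zero
    rw [regTerm, poch_one]
    field_simp
  rw [h1, norm_mul, norm_mul, norm_mul, norm_pow]
  calc _ ≤ (D * (5 / 4) ^ n) * (E * (5 / 4) ^ n) * (C * (5 / 4) ^ n) * (1 / 2) ^ n := by
        gcongr
        · exact hDb _
        · exact hEb _
        · exact hCb _
        · simp
    _ = _ := by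
        rw [show (125 / 128 : ℝ) = 5 / 4 * (5 / 4) * (5 / 4) * (1 / 2) by norm_num]
        simp only [mul_pow]
        ring

theorem tsum_regTerm_add_one (a b c : ℂ) :
    b * ∑' n, regTerm a (b + 1) c n =
      ∑' n, regTerm a b (c - 1) n - (c - b - 1) * ∑' n, regTerm a b c n := by
  rw [← tsum_mul_left, ← tsum_mul_left, ← (summable_regTerm a b (c - 1)).tsum_sub
    ((summable_regTerm a b c).mul_left _)]
  refine tsum_congr fun n => ?_
  rw [regTerm_eq_mul_regTerm_add_one a b (c - 1), sub_add_cancel]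
  have h : b * poch (b + 1) n = poch b n * (b + n) := by rw [← poch_succ_left, poch_succ]
  simp only [regTerm]
  linear_combination (poch a n / n.factorial * (Gamma (c + n))⁻¹ * (1 / 2) ^ n) * h

theorem tsum_regTerm_add_two (a c : ℂ) :
    ∑' n, regTerm a (1 - a) c n =
      (c + a) * (c + 1 - a) * ∑' n, regTerm a (1 - a) (c + 2) n := by
  let G : ℕ → ℂ := fun n => -2 * n * regTerm a (1 - a) (c + 1) n
  have hG (n : ℕ) : G n =
      -2 * (regTerm a (1 - a) c n - c * regTerm a (1 - a) (c + 1) n) := by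
    rw [regTerm_eq_mul_regTerm_add_one a (1 - a) c]
    simp only [G]
    ring
  have hlim : Filter.Tendsto G Filter.atTop (nhds 0) := by
    have h1 := (summable_regTerm a (1 - a) c).tendsto_atTop_zero
    have h2 := (summable_regTerm a (1 - a) (c + 1)).tendsto_atTop_zero
    simpa [← hG] using (h1.sub (h2.const_mul c)).const_mul (-2)
  have hdiff (n : ℕ) : regTerm a (1 - a) c n -
      (c + a) * (c + 1 - a) * regTerm a (1 - a) (c + 2) n = G (n + 1) - G n := by
    have h1 : regTerm a (1 - a) (c + 1) n = (c + 1 + n) * regTerm a (1 - a) (c + 2) n := by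
      rw [regTerm_eq_mul_regTerm_add_one, add_assoc c 1 1, one_add_one_eq_two]
    have h2 : (n + 1 : ℂ) * regTerm a (1 - a) (c + 1) (n + 1) =
        (a + n) * (1 - a + n) * (1 / 2) * regTerm a (1 - a) (c + 2) n := by
      have h3 : (n.factorial : ℂ) ≠ 0 := by exact_mod_cast n.factorial_ne_zero
      have h4 : (n + 1 : ℂ) ≠ 0 := by exact_mod_cast n.succ_ne_zero
      simp only [regTerm]
      rw [poch_succ, poch_succ, Nat.factorial_succ, pow_succ]
      push_cast
      rw [show c + 1 + ((n : ℂ) + 1) = c + 2 + n by ring]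
      field_simp
    simp only [G]
    push_cast
    rw [regTerm_eq_mul_regTerm_add_one a (1 - a) c, h1]
    linear_combination 2 * h2
  have hs := (summable_regTerm a (1 - a) c).sub
    ((summable_regTerm a (1 - a) (c + 2)).mul_left ((c + a) * (c + 1 - a)))
  have hs0 : Filter.Tendsto (fun N => ∑ n ∈ Finset.range N, (regTerm a (1 - a) c n -
      (c + a) * (c + 1 - a) * regTerm a (1 - a) (c + 2) n)) Filter.atTop (nhds 0) := by
    simp only [hdiff, Finset.sum_range_sub]
    simpa [G] using hlim
  have h0 := tendsto_nhds_unique hs.hasSum.tendsto_sum_nat hs0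
  rw [(summable_regTerm a (1 - a) c).tsum_sub ((summable_regTerm a (1 - a) (c + 2)).mul_left _),
    tsum_mul_left] at h0
  exact sub_eq_zero.1 h0

theorem tsum_regTerm_add_two_mul (a c : ℂ) (K : ℕ) :
    ∑' n, regTerm a (1 - a) c n =
      4 ^ K * poch ((c + a) / 2) K * poch ((c + 1 - a) / 2) K *
        ∑' n, regTerm a (1 - a) (c + 2 * K) n := by
  induction K with
  | zero => simp [poch_zero]
  | succ K ih =>
    rw [ih, tsum_regTerm_add_two, poch_succ, poch_succ]
    push_cast
    rw [show c + 2 * ((K : ℂ) + 1) = c + 2 * K + 2 by ring]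
    ring

theorem tendsto_tsum_poch_div_poch (a b c : ℂ) (hc : 0 < c.re) :
    Filter.Tendsto (fun K : ℕ => ∑' n : ℕ, poch a n * poch b n / (n.factorial) *
      (poch (c + 2 * K) n)⁻¹ * (1 / 2) ^ n) Filter.atTop (nhds 1) := by
  have hpos (k : ℕ) : 0 < ‖c + k‖ := by
    refine norm_pos_iff.2 fun h => ?_
    have h1 := congrArg re h
    have h2 : (0 : ℝ) ≤ k := k.cast_nonneg
    simp only [add_re, natCast_re, zero_re] at h1
    linarith
  have hle (K k : ℕ) : ‖c + k‖ ≤ ‖c + 2 * K + k‖ := by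
    refine le_of_sq_le_sq ?_ (norm_nonneg _)
    rw [← normSq_eq_norm_sq, ← normSq_eq_norm_sq, normSq_apply, normSq_apply]
    have h1 : (c + 2 * K + k).re = c.re + k + 2 * K := by simp; ring
    have h2 : (c + 2 * K + k).im = c.im := by simp
    have h3 : (c + k).re = c.re + k := by simp
    have h4 : (c + k).im = c.im := by simp
    have h5 : (0 : ℝ) ≤ k := k.cast_nonneg
    have h6 : (0 : ℝ) ≤ K := K.cast_nonneg
    rw [h1, h2, h3, h4]
    nlinarith
  have hlim (n : ℕ) : Filter.Tendsto (fun K : ℕ => poch a n * poch b n / (n.factorial) *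
      (poch (c + 2 * K) n)⁻¹ * (1 / 2) ^ n) Filter.atTop
      (nhds (poch a n * poch b n / (n.factorial) * 0 ^ n * (1 / 2) ^ n)) := by
    refine Filter.Tendsto.mul_const _ (Filter.Tendsto.const_mul _ ?_)
    have h : Filter.Tendsto (fun K : ℕ => ∏ k ∈ Finset.range n, (c + 2 * K + k)⁻¹) Filter.atTop
        (nhds (∏ k ∈ Finset.range n, 0)) := by
      refine tendsto_finsetProd _ fun k _ => ?_
      refine Filter.tendsto_inv₀_cobounded.comp ?_
      rw [← tendsto_norm_atTop_iff_cobounded]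
      refine Filter.tendsto_atTop_mono (fun K => ?_)
        (tendsto_natCast_atTop_atTop (R := ℝ))
      refine le_trans ?_ (abs_re_le_norm _)
      refine le_trans ?_ (le_abs_self _)
      have h1 : (c + 2 * K + k).re = c.re + k + 2 * K := by simp; ring
      have h5 : (0 : ℝ) ≤ k := k.cast_nonneg
      have h6 : (0 : ℝ) ≤ K := K.cast_nonneg
      rw [h1]
      linarith
    simpa [poch, Finset.prod_inv_distrib] using h
  have h := tendsto_tsum_of_dominated_convergence
    (summable_hypergeometric a b c (r := 1 / 2) (by norm_num) (by norm_num)) hlim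
    (Filter.Eventually.of_forall fun K n => ?_)
  · rw [tsum_eq_single 0 (fun n hn => by simp [hn])] at h
    simpa [poch_zero] using h
  · rw [mul_comm (poch c n), ← div_div, div_eq_mul_inv (_ / _) (poch c n), norm_mul, norm_mul,
      norm_pow, norm_mul _ (poch c n)⁻¹, norm_inv, norm_inv]
    have h1 : ‖poch c n‖ ≤ ‖poch (c + 2 * K) n‖ := by
      rw [poch, poch, norm_prod, norm_prod]
      exact Finset.prod_le_prod (fun _ _ => norm_nonneg _) fun k _ => hle K k
    have h2 : 0 < ‖poch c n‖ := by
      rw [poch, norm_prod]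
      exact Finset.prod_pos fun k _ => hpos k
    gcongr
    simp

theorem Gamma_add_natCast_eq_mul_poch {s : ℂ} (hs : notNonposInt s) (n : ℕ) :
    Gamma (s + n) = Gamma s * poch s n := by
  induction n with
  | zero => simp [poch_zero]
  | succ n ih =>
    rw [poch_succ, ← mul_assoc, ← ih, Nat.cast_succ, ← add_assoc, Gamma_add_one, mul_comm]
    intro h
    exact hs n (eq_neg_of_add_eq_zero_left h)

theorem poch_ne_zero {s : ℂ} (hs : notNonposInt s) (n : ℕ) : poch s n ≠ 0 :=
  Finset.prod_ne_zero_iff.2 fun k _ h => hs k (eq_neg_of_add_eq_zero_left h)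

theorem notNonposInt_of_re_pos {s : ℂ} (hs : 0 < s.re) : notNonposInt s := by
  intro n h
  rw [h, neg_re, natCast_re] at hs
  have : (0 : ℝ) ≤ n := n.cast_nonneg
  linarith

theorem poch_add_one_eq_GammaSeq (s : ℂ) {n : ℕ} (hn : n ≠ 0) :
    poch s (n + 1) = (n : ℂ) ^ s * n.factorial * (GammaSeq s n)⁻¹ := by
  have h1 : (n : ℂ) ^ s ≠ 0 := by
    rw [Ne, cpow_eq_zero_iff]
    simp [hn]
  have h2 : (n.factorial : ℂ) ≠ 0 := by exact_mod_cast n.factorial_ne_zero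
  rw [GammaSeq, inv_div, mul_div_cancel₀ _ (mul_ne_zero h1 h2), poch]

theorem tendsto_inv_GammaSeq (s : ℂ) :
    Filter.Tendsto (fun n => (GammaSeq s n)⁻¹) Filter.atTop (nhds (Gamma s)⁻¹) := by
  by_cases h : Gamma s = 0
  · obtain ⟨m, rfl⟩ := (Gamma_eq_zero_iff s).1 h
    refine (tendsto_const_nhds (x := (Gamma (-(m : ℂ)))⁻¹)).congr' ?_
    filter_upwards [Filter.eventually_ge_atTop m] with n hn
    rw [h, GammaSeq, Finset.prod_eq_zero (Finset.mem_range.2 (Nat.lt_succ_of_le hn)) (by simp)]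
    simp
  · exact (GammaSeq_tendsto_Gamma s).inv₀ h

theorem tendsto_poch_ratio {u v p q : ℂ} (h : u + v = p + q) (hp : notNonposInt p)
    (hq : notNonposInt q) :
    Filter.Tendsto (fun K => poch u K * poch v K / (poch p K * poch q K)) Filter.atTop
      (nhds (Gamma p * Gamma q * (Gamma u)⁻¹ * (Gamma v)⁻¹)) := by
  rw [← Filter.tendsto_add_atTop_iff_nat 1]
  refine ((((GammaSeq_tendsto_Gamma p).mul (GammaSeq_tendsto_Gamma q)).mul
    (tendsto_inv_GammaSeq u)).mul (tendsto_inv_GammaSeq v)).congr' ?_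
  filter_upwards [Filter.eventually_ne_atTop 0] with n hn
  have hn' : (n : ℂ) ≠ 0 := by exact_mod_cast hn
  have h2 : (n.factorial : ℂ) ≠ 0 := by exact_mod_cast n.factorial_ne_zero
  have h3 : (n : ℂ) ^ u * (n : ℂ) ^ v = (n : ℂ) ^ p * (n : ℂ) ^ q := by
    rw [← cpow_add _ _ hn', ← cpow_add _ _ hn', h]
  have h1 (s : ℂ) : (n : ℂ) ^ s ≠ 0 := by
    rw [Ne, cpow_eq_zero_iff]
    simp [hn]
  have hpp := poch_ne_zero hp (n + 1)
  have hqq := poch_ne_zero hq (n + 1)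
  rw [eq_div_iff (mul_ne_zero hpp hqq)]
  have hP : GammaSeq p n * poch p (n + 1) = (n : ℂ) ^ p * n.factorial := by
    rw [poch_add_one_eq_GammaSeq p hn] at hpp ⊢
    have : GammaSeq p n ≠ 0 := fun h => right_ne_zero_of_mul hpp (by rw [h, inv_zero])
    field_simp
  have hQ : GammaSeq q n * poch q (n + 1) = (n : ℂ) ^ q * n.factorial := by
    rw [poch_add_one_eq_GammaSeq q hn] at hqq ⊢
    have : GammaSeq q n ≠ 0 := fun h => right_ne_zero_of_mul hqq (by rw [h, inv_zero])
    field_simp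
  rw [poch_add_one_eq_GammaSeq u hn, poch_add_one_eq_GammaSeq v hn]
  calc _ = (GammaSeq p n * poch p (n + 1)) * (GammaSeq q n * poch q (n + 1)) *
        (GammaSeq u n)⁻¹ * (GammaSeq v n)⁻¹ := by ring
    _ = _ := by
        rw [hP, hQ]
        linear_combination
          (-(n.factorial : ℂ) ^ 2 * (GammaSeq u n)⁻¹ * (GammaSeq v n)⁻¹) * h3

theorem tsum_regTerm_of_re_pos (a c : ℂ) (hc : 0 < c.re) :
    ∑' n, regTerm a (1 - a) c n =
      2 ^ (1 - c) * (√Real.pi : ℝ) * (Gamma ((c + a) / 2))⁻¹ * (Gamma ((c + 1 - a) / 2))⁻¹ := by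
  have hp : notNonposInt (c / 2) := notNonposInt_of_re_pos (by simpa using hc)
  have hq : notNonposInt ((c + 1) / 2) := notNonposInt_of_re_pos (by
    rw [div_ofNat_re, add_re, one_re]
    positivity)
  have hlim := ((tendsto_poch_ratio (u := (c + a) / 2) (v := (c + 1 - a) / 2) (by ring) hp
    hq).mul (tendsto_tsum_poch_div_poch a (1 - a) c hc)).const_mul
      (2 ^ (1 - c) * (√Real.pi : ℝ) * (Gamma (c / 2))⁻¹ * (Gamma ((c + 1) / 2))⁻¹)
  have hΓp : Gamma (c / 2) ≠ 0 := Gamma_ne_zero hp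
  have hΓq : Gamma ((c + 1) / 2) ≠ 0 := Gamma_ne_zero hq
  have hconst (K : ℕ) : 2 ^ (1 - c) * (√Real.pi : ℝ) * (Gamma (c / 2))⁻¹ *
      (Gamma ((c + 1) / 2))⁻¹ * (poch ((c + a) / 2) K * poch ((c + 1 - a) / 2) K /
      (poch (c / 2) K * poch ((c + 1) / 2) K) * ∑' n : ℕ, poch a n * poch (1 - a) n /
      (n.factorial) * (poch (c + 2 * K) n)⁻¹ * (1 / 2) ^ n) = ∑' n, regTerm a (1 - a) c n := by
    have hcK : notNonposInt (c + 2 * K) := notNonposInt_of_re_pos (by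
      have h6 : (0 : ℝ) ≤ K := K.cast_nonneg
      simp
      linarith)
    have h1 : ∑' n, regTerm a (1 - a) (c + 2 * K) n = (Gamma (c + 2 * K))⁻¹ *
        ∑' n : ℕ, poch a n * poch (1 - a) n /
          (n.factorial) * (poch (c + 2 * K) n)⁻¹ * (1 / 2) ^ n := by
      rw [← tsum_mul_left]
      refine tsum_congr fun n => ?_
      rw [regTerm, Gamma_add_natCast_eq_mul_poch hcK, mul_inv]
      ring
    have h2 := Gamma_mul_Gamma_add_half (c / 2 + K)
    rw [show c / 2 + K + 1 / 2 = (c + 1) / 2 + K by ring,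
      show 2 * (c / 2 + K) = c + 2 * K by ring, Gamma_add_natCast_eq_mul_poch hp,
      Gamma_add_natCast_eq_mul_poch hq] at h2
    have h3 : (2 : ℂ) ^ (1 - (c + 2 * K)) * 4 ^ K = 2 ^ (1 - c) := by
      rw [← sub_sub, cpow_sub _ _ two_ne_zero, show (2 * K : ℂ) = ((2 * K : ℕ) : ℂ) by simp,
        cpow_natCast, pow_mul]
      norm_num
    have h4 := Gamma_ne_zero hcK
    have h5 := poch_ne_zero hp K
    have h6 := poch_ne_zero hq K
    have h7 : (2 : ℂ) ^ (1 - c) * (√Real.pi : ℝ) * (Gamma (c / 2))⁻¹ *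
        (Gamma ((c + 1) / 2))⁻¹ / (poch (c / 2) K * poch ((c + 1) / 2) K) =
        4 ^ K * (Gamma (c + 2 * K))⁻¹ := by
      field_simp
      rw [← h3]
      linear_combination (-(4 : ℂ) ^ K) * h2
    rw [tsum_regTerm_add_two_mul a c K, h1]
    linear_combination (poch ((c + a) / 2) K * poch ((c + 1 - a) / 2) K *
      ∑' n : ℕ, poch a n * poch (1 - a) n /
          (n.factorial) * (poch (c + 2 * K) n)⁻¹ * (1 / 2) ^ n) * h7
  simp only [hconst] at hlim
  rw [tendsto_nhds_unique tendsto_const_nhds hlim]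
  field_simp

/-- Bailey's summation theorem, in a form valid for all parameters. -/
theorem tsum_regTerm_one_sub (a c : ℂ) :
    ∑' n, regTerm a (1 - a) c n =
      2 ^ (1 - c) * (√Real.pi : ℝ) * (Gamma ((c + a) / 2))⁻¹ * (Gamma ((c + 1 - a) / 2))⁻¹ := by
  obtain ⟨m, hm⟩ := exists_nat_gt (-c.re)
  induction m generalizing c with
  | zero => exact tsum_regTerm_of_re_pos a c (by simpa using hm)
  | succ m ih =>
    rw [tsum_regTerm_add_two, ih (c + 2) (by
      push_cast at hm
      simp
      linarith),
      one_div_Gamma_eq_self_mul_one_div_Gamma_add_one ((c + a) / 2),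
      one_div_Gamma_eq_self_mul_one_div_Gamma_add_one ((c + 1 - a) / 2),
      show (c + 2 + a) / 2 = (c + a) / 2 + 1 by ring,
      show (c + 2 + 1 - a) / 2 = (c + 1 - a) / 2 + 1 by ring,
      show (1 : ℂ) - (c + 2) = 1 - c - (2 : ℕ) by push_cast; ring, cpow_sub _ _ two_ne_zero,
      cpow_natCast]
    ring

theorem tsum_regTerm_one_sub_eq_Gamma_div (a c : ℂ) (h : notNonposInt ((c + a - 1) / 2)) :
    ∑' n, regTerm a (1 - a) c n = 2 ^ (a - 1) * (Gamma (c + a - 1))⁻¹ *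
      (Gamma ((c + a - 1) / 2) / Gamma ((c - a + 1) / 2)) := by
  have h1 := Gamma_mul_Gamma_add_half ((c + a - 1) / 2)
  rw [show (c + a - 1) / 2 + 1 / 2 = (c + a) / 2 by ring,
    show 2 * ((c + a - 1) / 2) = c + a - 1 by ring] at h1
  have h2 := Gamma_ne_zero h
  have h3 : (2 : ℂ) ^ (1 - c) = 2 ^ (a - 1) * 2 ^ (1 - (c + a - 1)) := by
    rw [← cpow_add _ _ two_ne_zero]
    congr 1
    ring
  have h4 : (Gamma ((c + a) / 2))⁻¹ * 2 ^ (1 - (c + a - 1)) * (√Real.pi : ℝ) =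
      (Gamma (c + a - 1))⁻¹ * Gamma ((c + a - 1) / 2) := by
    by_cases h5 : Gamma (c + a - 1) = 0
    · rw [h5, zero_mul, zero_mul] at h1
      rw [h5, (mul_eq_zero.1 h1).resolve_left h2]
      simp
    · have h6 : Gamma ((c + a) / 2) ≠ 0 := by
        refine right_ne_zero_of_mul (a := Gamma ((c + a - 1) / 2)) ?_
        rw [h1]
        refine mul_ne_zero (mul_ne_zero h5 ?_) ?_
        · simp [cpow_eq_zero_iff]
        · exact_mod_cast (Real.sqrt_pos.2 Real.pi_pos).ne'
      field_simp
      linear_combination -h1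
  rw [tsum_regTerm_one_sub, h3, show c + 1 - a = c - a + 1 by ring]
  linear_combination (2 ^ (a - 1) * (Gamma ((c - a + 1) / 2))⁻¹) * h4

theorem sum_range_neg_one_pow_choose_succ (φ : ℕ → ℂ) (i : ℕ) :
    ∑ r ∈ Finset.range (i + 2), (-1) ^ r * ((i + 1).choose r : ℂ) * φ r =
      ∑ r ∈ Finset.range (i + 1), (-1) ^ r * (i.choose r : ℂ) * φ r -
        ∑ r ∈ Finset.range (i + 1), (-1) ^ r * (i.choose r : ℂ) * φ (r + 1) := by
  have h := Finset.sum_choose_succ_mul (fun r _ => (-1) ^ r * φ r) i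
  simp only [mul_left_comm _ ((-1 : ℂ) ^ _) (φ _), ← mul_assoc] at h
  rw [h, sub_eq_add_neg, ← Finset.sum_neg_distrib]
  congr 1
  refine Finset.sum_congr rfl fun r _ => ?_
  ring

theorem poch_mul_tsum_regTerm (a c : ℂ) (i : ℕ)
    (h : ∀ r ≤ i, notNonposInt ((c + a - i + r - 1) / 2)) :
    poch (1 - a) i * ∑' n, regTerm a (1 - a + i) c n =
      2 ^ (a - 1) * (Gamma (c + a - i - 1))⁻¹ *
        ∑ r ∈ Finset.range (i + 1), (-1) ^ r * (i.choose r : ℂ) *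
          (Gamma ((c + a - i + r - 1) / 2) / Gamma ((c - a - i + r + 1) / 2)) := by
  induction i generalizing c with
  | zero =>
    have h0 := h 0 le_rfl
    simp only [Nat.cast_zero, add_zero, sub_zero] at h0
    simpa [poch_zero] using tsum_regTerm_one_sub_eq_Gamma_div a c h0
  | succ i ih =>
    have h1 := ih (c - 1) fun r hr => by
      have := h r (by omega)
      push_cast at this
      convert! this using 2
      ring
    have h2 := ih c fun r hr => by
      have := h (r + 1) (by omega)
      push_cast at this
      convert! this using 2
      ring
    have h3 := tsum_regTerm_add_one a (1 - a + i) c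
    have h4 := one_div_Gamma_eq_self_mul_one_div_Gamma_add_one (c + a - i - 2)
    rw [show c + a - i - 2 + 1 = c + a - i - 1 by ring] at h4
    rw [show c - 1 + a - i - 1 = c + a - i - 2 by ring] at h1
    rw [sum_range_neg_one_pow_choose_succ, poch_succ]
    push_cast
    have e1 (r : ℕ) : (c + a - (i + 1) + r - 1) / 2 = (c - 1 + a - i + r - 1) / 2 := by ring
    have e2 (r : ℕ) : (c - a - (i + 1) + r + 1) / 2 = (c - 1 - a - i + r + 1) / 2 := by ring
    have e3 (r : ℕ) : (c + a - (i + 1) + (r + 1) - 1) / 2 = (c + a - i + r - 1) / 2 := by ring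
    have e4 (r : ℕ) : (c - a - (i + 1) + (r + 1) + 1) / 2 = (c - a - i + r + 1) / 2 := by ring
    simp only [e1, e2, e3, e4]
    rw [mul_sub, show c + a - (i + 1 : ℂ) - 1 = c + a - i - 2 by ring, ← h1, mul_assoc,
      ← add_assoc (1 - a) (i : ℂ) 1, h3, h4]
    linear_combination (-(c + a - i - 2)) * h2

theorem stmt_11 (i : ℕ) (α β ε : ℂ)
    (hβ : ∀ m n : ℕ, poch β (m + n) ≠ 0)
    (hΓ1 : notNonposInt (1 - ε))
    (hΓ2 : notNonposInt (β))
    (hΓ3 : notNonposInt (1 - ε + (i : ℂ)))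
    (hΓ4 : notNonposInt (β + ε - (i : ℂ) - 1))
    (hΓs : ∀ r : ℕ, r ≤ i →
      notNonposInt ((β + ε - (i : ℂ) + (r : ℂ) - 1) / 2) ∧ notNonposInt ((β - ε - (i : ℂ) + (r : ℂ) + 1) / 2))
    (hsum : Summable fun p : ℕ × ℕ => ‖kdfTerm α ε (β - ε) (1 - α - ε + (i : ℂ)) β (1/2) (-1) p‖) :
    (∑' p : ℕ × ℕ, kdfTerm α ε (β - ε) (1 - α - ε + (i : ℂ)) β (1/2) (-1) p) =
      (2 : ℂ) ^ (α - (i : ℂ) + 2 * ε - 2) * Gamma (1 - ε) * Gamma β /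
        (Gamma (1 - ε + (i : ℂ)) * Gamma (β + ε - (i : ℂ) - 1)) *
      ∑ r ∈ Finset.range (i + 1), (-1 : ℂ) ^ r * (i.choose r : ℂ) *
        Gamma ((β + ε - (i : ℂ) + (r : ℂ) - 1) / 2) /
        Gamma ((β - ε - (i : ℂ) + (r : ℂ) + 1) / 2) := by
  have h1 : ∑' N : ℕ, poch ε N * poch (α + (1 - α - ε + i)) N / (poch β N * N.factorial) *
      (1 / 2) ^ N = Gamma β * ∑' n, regTerm ε (1 - ε + i) β n := by
    rw [← tsum_mul_left]
    refine tsum_congr fun n => ?_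
    have h2 := Gamma_ne_zero hΓ2
    rw [regTerm, Gamma_add_natCast_eq_mul_poch hΓ2, mul_inv,
      show α + (1 - α - ε + i) = 1 - ε + i by ring]
    field_simp
  have h2 := poch_mul_tsum_regTerm ε β i fun r hr => (hΓs r hr).1
  have h3 : (2 : ℂ) ^ (α - (i : ℂ) + 2 * ε - 2) = 2 ^ (-(1 - α - ε + (i : ℂ))) * 2 ^ (ε - 1) := by
    rw [← cpow_add _ _ two_ne_zero]
    congr 1
    ring
  have h4 := Gamma_ne_zero hΓ1
  have h5 := poch_ne_zero hΓ1 i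
  rw [tsum_kdfTerm_eq_hypergeometric _ _ _ _ (poch_ne_zero hΓ2) hsum, h1,
    Gamma_add_natCast_eq_mul_poch hΓ1, h3]
  simp only [mul_div_assoc]
  rw [← mul_right_inj' h5]
  calc _ = 2 ^ (-(1 - α - ε + (i : ℂ))) * Gamma β *
        (poch (1 - ε) i * ∑' n, regTerm ε (1 - ε + i) β n) := by ring
    _ = _ := by
        rw [h2]
        field_simp
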